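/- Under Condition (A) (nQ₁(n) = o(Q₂(n))), let h*(n) be an integer-valued function satisfying (α₁A₂₁/(1-α₁)) h*(n) Q₁(h*(n)) ~ Q₂(n). Then for any λ₁, λ₂, a > 0, setting s₁ = 1 - λ₁Q₁(h*(n)) and s₂ = 1 - λ₂Q₂(n), as n → ∞: Σ_{k=0}^{n-1} Q₁(k; s₁) ~ (λ₁^{1-α₁}/A₂₁) Q₂(n), Σ_{k=0}^{⌊ah*(n)⌋-1} Q₁(k; s₁) ~ (λ₁^{1-α₁}/A₂₁)(1 - (1 + aλ₁^{α₁})^{1-1/α₁}) Q₂(n), and lim_{n→∞} Q₂₁(⌊ah*(n)⌋; s₁, s₂)/Q₂(n) = λ₁^{1-α₁}(1 - (1 + aλ₁^{α₁})^{1-1/α₁}) + λ₂. -/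

import Mathlib

open MeasureTheory Filter Topology

/-- `a(n) ~ b(n)` : the ratio tends to `1` as `n → ∞`. -/
def Asymp (f g : ℕ → ℝ) : Prop :=
  Filter.Tendsto (fun n => f n / g n) Filter.atTop (nhds 1)

/-- A critical decomposable two-type Galton–Watson process together with its
reduced process.  `P1` is the law of the process started from one particle of
type 1 (`Z(0) = e₁`), `P2` the law started from one particle of type 2
(`Z(0) = e₂`).  `Z1 n`/`Z2 n` are the numbers of particles of types 1 and 2 at
time `n`; `R1 m n`/`R2 m n` are the numbers of particles of types 1 and 2 alive
at time `m` having descendants at time `n` (the reduced process). -/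
structure GWSetup where
  (Ω : Type)
  [mΩ : MeasurableSpace Ω]
  (P1 : Measure Ω)
  (P2 : Measure Ω)
  (hprob1 : IsProbabilityMeasure P1)
  (hprob2 : IsProbabilityMeasure P2)
  (Z1 : ℕ → Ω → ℕ)
  (Z2 : ℕ → Ω → ℕ)
  (R1 : ℕ → ℕ → Ω → ℕ)
  (R2 : ℕ → ℕ → Ω → ℕ)
  (mZ1 : ∀ n, Measurable (Z1 n))
  (mZ2 : ∀ n, Measurable (Z2 n))
  (mR1 : ∀ m n, Measurable (R1 m n))
  (mR2 : ∀ m n, Measurable (R2 m n))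
  (α1 : ℝ)
  (α2 : ℝ)
  (A21 : ℝ)
  (L1 : ℝ → ℝ)
  (L2 : ℝ → ℝ)
  (ρ : ℝ → ℝ → ℝ)
  (hα1 : 0 < α1 ∧ α1 ≤ 1)
  (hα2 : 0 < α2 ∧ α2 ≤ 1)
  (hA21 : 0 < A21)
  -- initial states
  (hinit1 : ∀ᵐ ω ∂P1, Z1 0 ω = 1 ∧ Z2 0 ω = 0)
  (hinit2 : ∀ᵐ ω ∂P2, Z1 0 ω = 0 ∧ Z2 0 ω = 1)
  -- type-1 particles produce only type-1 particles
  (hdecomp : ∀ n, ∀ᵐ ω ∂P1, Z2 n ω = 0)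
  -- criticality
  (hcrit1 : (∫ ω, (Z1 1 ω : ℝ) ∂P1) = 1)
  (hcrit2 : (∫ ω, (Z2 1 ω : ℝ) ∂P2) = 1)
  -- mean number of type-1 children of a type-2 particle
  (hmean21 : (∫ ω, (Z1 1 ω : ℝ) ∂P2) = A21)
  -- assumption (F1)
  (hF1 : ∀ s : ℝ, 0 ≤ s → s < 1 →
    (∫ ω, s ^ Z1 1 ω ∂P1) = s + (1 - s) ^ (1 + α1) * L1 (1 - s))
  -- assumption (F2)
  (hF2 : ∀ s1 s2 : ℝ, 0 ≤ s1 → s1 ≤ 1 → 0 ≤ s2 → s2 < 1 →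
    (∫ ω, s1 ^ Z1 1 ω * s2 ^ Z2 1 ω ∂P2) =
      s2 + (1 - s2) ^ (1 + α2) * L2 (1 - s2) - (A21 - ρ s1 s2) * (1 - s1))
  -- `L1`, `L2` are slowly varying at `0`
  (hL1 : ∀ c : ℝ, 0 < c →
    Filter.Tendsto (fun x => L1 (c * x) / L1 x) (nhdsWithin 0 (Set.Ioi 0)) (nhds 1))
  (hL2 : ∀ c : ℝ, 0 < c →
    Filter.Tendsto (fun x => L2 (c * x) / L2 x) (nhdsWithin 0 (Set.Ioi 0)) (nhds 1))
  -- `ρ(s₁,s₂) → 0` as `s₁ s₂ ↑ 1`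
  (hρ : ∀ ε : ℝ, 0 < ε → ∃ δ : ℝ, 0 < δ ∧ ∀ s1 s2 : ℝ,
    0 ≤ s1 → s1 ≤ 1 → 0 ≤ s2 → s2 ≤ 1 → 1 - δ < s1 * s2 → |ρ s1 s2| < ε)
  -- branching (semigroup) property at the level of generating functions
  (hbranch1 : ∀ m n : ℕ, ∀ s : ℝ, 0 ≤ s → s ≤ 1 →
    (∫ ω, s ^ Z1 (m + n) ω ∂P1) = ∫ ω, (∫ ω', s ^ Z1 n ω' ∂P1) ^ Z1 m ω ∂P1)
  (hbranch2 : ∀ m n : ℕ, ∀ s1 s2 : ℝ, 0 ≤ s1 → s1 ≤ 1 → 0 ≤ s2 → s2 ≤ 1 →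
    (∫ ω, s1 ^ Z1 (m + n) ω * s2 ^ Z2 (m + n) ω ∂P2) =
      ∫ ω, (∫ ω', s1 ^ Z1 n ω' ∂P1) ^ Z1 m ω *
        (∫ ω', s1 ^ Z1 n ω' * s2 ^ Z2 n ω' ∂P2) ^ Z2 m ω ∂P2)
  -- the reduced process vanishes on the extinction event
  (hext : ∀ m n : ℕ, ∀ᵐ ω ∂P2,
    (Z1 n ω = 0 ∧ Z2 n ω = 0) → (R1 m n ω = 0 ∧ R2 m n ω = 0))
  -- the generating function of the reduced process (conditioning on `Z(m)`)
  (hreduced : ∀ m n : ℕ, m ≤ n → ∀ s1 s2 : ℝ, 0 ≤ s1 → s1 ≤ 1 → 0 ≤ s2 → s2 ≤ 1 →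
    (∫ ω, s1 ^ R1 m n ω * s2 ^ R2 m n ω ∂P2) =
      ∫ ω, (1 - (1 - s1) * (P1 {ω' | Z1 (n - m) ω' ≠ 0}).toReal) ^ Z1 m ω *
        (1 - (1 - s2) *
          (P2 {ω' | Z1 (n - m) ω' ≠ 0 ∨ Z2 (n - m) ω' ≠ 0}).toReal) ^ Z2 m ω ∂P2)

namespace GWSetup

variable (S : GWSetup)

/-- The survival event `{Z(n) ≠ 0}` (under the law `P2`). -/
def surv (n : ℕ) : Set S.Ω := {ω | S.Z1 n ω ≠ 0 ∨ S.Z2 n ω ≠ 0}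

/-- `Q₁(n) = P(Z₁(n) > 0 | Z(0) = e₁)`. -/
noncomputable def Q1 (n : ℕ) : ℝ := (S.P1 {ω | S.Z1 n ω ≠ 0}).toReal

/-- `Q₂(n) = P(Z₂(n) > 0 | Z(0) = e₂)`. -/
noncomputable def Q2 (n : ℕ) : ℝ := (S.P2 {ω | S.Z2 n ω ≠ 0}).toReal

/-- `Q₂₁(n) = P(Z(n) ≠ 0 | Z(0) = e₂)`. -/
noncomputable def Q21 (n : ℕ) : ℝ := (S.P2 (S.surv n)).toReal

/-- `F₁(n; s) = E[s^{Z₁(n)} | Z(0) = e₁]`. -/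
noncomputable def F1 (n : ℕ) (s : ℝ) : ℝ := ∫ ω, s ^ S.Z1 n ω ∂S.P1

/-- `F₂₁(n; s₁, s₂) = E[s₁^{Z₁(n)} s₂^{Z₂(n)} | Z(0) = e₂]`. -/
noncomputable def F21 (n : ℕ) (s1 s2 : ℝ) : ℝ :=
  ∫ ω, s1 ^ S.Z1 n ω * s2 ^ S.Z2 n ω ∂S.P2

/-- `Q₁(n; s) = 1 - F₁(n; s)`. -/
noncomputable def Q1s (n : ℕ) (s : ℝ) : ℝ := 1 - S.F1 n s

/-- `Q₂(n; s) = 1 - E[s^{Z₂(n)} | Z(0) = e₂]`. -/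
noncomputable def Q2s (n : ℕ) (s : ℝ) : ℝ := 1 - S.F21 n 1 s

/-- `Q₂₁(n; s₁, s₂) = 1 - F₂₁(n; s₁, s₂)`. -/
noncomputable def Q21s (n : ℕ) (s1 s2 : ℝ) : ℝ := 1 - S.F21 n s1 s2

/-- The conditional expectation
`E[f(Z₁(m,n), Z₂(m,n)) | Z(n) ≠ 0, Z(0) = e₂]` for the reduced process. -/
noncomputable def Ered (m n : ℕ) (f : ℕ → ℕ → ℝ) : ℝ :=
  (∫ ω in S.surv n, f (S.R1 m n ω) (S.R2 m n ω) ∂S.P2) / S.Q21 n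

/-- The conditional probability `P(E | Z(n) ≠ 0, Z(0) = e₂)`. -/
noncomputable def Pred (n : ℕ) (E : Set S.Ω) : ℝ :=
  (S.P2 (E ∩ S.surv n)).toReal / S.Q21 n

/-- The birth time `β_n` of the most recent common ancestor of the population
alive at time `n`:  `β_n = max {m < n : Z₁(m,n) + Z₂(m,n) = 1}`. -/
noncomputable def beta (n : ℕ) (ω : S.Ω) : ℕ :=
  sSup {m | m < n ∧ S.R1 m n ω + S.R2 m n ω = 1}

/-- The type `T_n` of the most recent common ancestor: the `i ∈ {1,2}` with
`Z_i(β_n, n) = 1`. -/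
noncomputable def mrcaType (n : ℕ) (ω : S.Ω) : ℕ :=
  if S.R2 (S.beta n ω) n ω = 1 then 2 else 1

/-- Condition (A): `n Q₁(n) = o(Q₂(n))`. -/
def CondA : Prop :=
  Filter.Tendsto (fun n : ℕ => (n : ℝ) * S.Q1 n / S.Q2 n) Filter.atTop (nhds 0)

/-- Condition (B): `Q₂(n) = o(n Q₁(n))`. -/
def CondB : Prop :=
  Filter.Tendsto (fun n : ℕ => S.Q2 n / ((n : ℝ) * S.Q1 n)) Filter.atTop (nhds 0)

/-- Condition (C): `n Q₁(n) ~ σ Q₂(n)`. -/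
def CondC (σ : ℝ) : Prop := Asymp (fun n : ℕ => (n : ℝ) * S.Q1 n) (fun n => σ * S.Q2 n)

/-- `h*` is an integer-valued function with
`(α₁ A₂₁ / (1 - α₁)) h*(n) Q₁(h*(n)) ~ Q₂(n)`. -/
def IsHStar (h : ℕ → ℕ) : Prop :=
  Asymp (fun n : ℕ => S.α1 * S.A21 / (1 - S.α1) * (h n : ℝ) * S.Q1 (h n)) S.Q2

/-- `g*` is an integer-valued function with `Q₂(g*(n)) ~ Q₂₁(n)`. -/
def IsGStar (g : ℕ → ℕ) : Prop := Asymp (fun n => S.Q2 (g n)) S.Q21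

end GWSetup

/-- The decrement `φ` of a critical iteration `x ↦ x - φ x` on `[0, 1]`: `φ` is convex and
regularly varying at `0` with index `1 + α`. -/
structure CriticalStep (φ : ℝ → ℝ) (α : ℝ) : Prop where
  convex : ConvexOn ℝ (Set.Icc 0 1) φ
  map_zero : φ 0 = 0
  nonneg : ∀ x ∈ Set.Icc (0 : ℝ) 1, 0 ≤ φ x
  monotone_step : MonotoneOn (fun x => x - φ x) (Set.Icc 0 1)
  index_pos : 0 < α
  regular : ∀ c : ℝ, 0 < c → Tendsto (fun x => φ (c * x) / φ x) (𝓝[>] 0) (𝓝 (c ^ (1 + α)))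

lemma tendsto_rpow_slope_one (p : ℝ) :
    Tendsto (fun c : ℝ => (c ^ p - 1) / (c - 1)) (𝓝[≠] 1) (𝓝 p) := by
  have h := (Real.hasDerivAt_rpow_const (x := 1) (p := p) (Or.inl one_ne_zero))
  rw [hasDerivAt_iff_tendsto_slope] at h
  simp only [Real.one_rpow, mul_one] at h
  refine h.congr fun c => ?_
  rw [slope_def_field, Real.one_rpow]

namespace CriticalStep

variable {φ : ℝ → ℝ} {α : ℝ}

/-- The time scale `x / φ x` of the iteration at level `x`. -/
noncomputable def timeScale (φ : ℝ → ℝ) (x : ℝ) : ℝ := x / φ x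

lemma mul_map_le_mul_map (h : CriticalStep φ α) {x y : ℝ} (hx : 0 ≤ x) (hxy : x ≤ y) (hy : y ≤ 1) :
    y * φ x ≤ x * φ y := by
  rcases hx.eq_or_lt with rfl | hx
  · simp [h.map_zero]
  have hy0 : 0 < y := hx.trans_le hxy
  have hab : 0 ≤ 1 - x / y := by rwa [sub_nonneg, div_le_one hy0]
  have := h.convex.2 (Set.left_mem_Icc.2 zero_le_one) (Set.mem_Icc.2 ⟨hy0.le, hy⟩) hab
    (div_pos hx hy0).le (sub_add_cancel 1 (x / y))
  simp only [smul_eq_mul, mul_zero, zero_add, h.map_zero, div_mul_cancel₀ x hy0.ne'] at this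
  calc y * φ x ≤ y * (x / y * φ y) := by gcongr
    _ = x * φ y := by field_simp

lemma monotoneOn (h : CriticalStep φ α) : MonotoneOn φ (Set.Icc 0 1) := by
  intro x hx y hy hxy
  rcases hy.1.eq_or_lt with h0 | h0
  · rw [show x = y by linarith [hx.1]]
  · have h1 := h.mul_map_le_mul_map hx.1 hxy hy.2
    have h2 : x * φ y ≤ y * φ y := mul_le_mul_of_nonneg_right hxy (h.nonneg y hy)
    exact le_of_mul_le_mul_left (h1.trans h2) h0

lemma eventually_mem {b : ℝ} (hb : 0 < b) : ∀ᶠ x : ℝ in 𝓝[>] 0, 0 < x ∧ x < b :=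
  Ioo_mem_nhdsGT hb

lemma pos (h : CriticalStep φ α) {x : ℝ} (hx : 0 < x) (hx1 : x ≤ 1) : 0 < φ x := by
  have h1 := h.regular 2 two_pos
  have h2 : (0 : ℝ) < 2 ^ (1 + α) := by positivity
  obtain ⟨y, hy, hy0, hyx⟩ := ((h1.eventually (lt_mem_nhds h2)).and (eventually_mem hx)).exists
  have hne : φ y ≠ 0 := fun h0 => by simp [h0] at hy
  exact ((h.nonneg y ⟨hy0.le, (hyx.le.trans hx1)⟩).lt_of_ne' hne).trans_le
    (h.monotoneOn ⟨hy0.le, hyx.le.trans hx1⟩ ⟨hx.le, hx1⟩ hyx.le)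

lemma tendsto_div_self (h : CriticalStep φ α) :
    Tendsto (fun x => φ x / x) (𝓝[>] 0) (𝓝 0) := by
  have hmono : MonotoneOn (fun x => φ x / x) (Set.Ioo 0 1) := by
    intro x hx y hy hxy
    have h1 := h.mul_map_le_mul_map hx.1.le hxy hy.2.le
    simp only
    rw [div_le_div_iff₀ hx.1 hy.1]
    linarith
  have hbdd : BddBelow ((fun x => φ x / x) '' Set.Ioo 0 1) := by
    refine ⟨0, ?_⟩
    rintro _ ⟨x, hx, rfl⟩
    exact div_nonneg (h.nonneg x ⟨hx.1.le, hx.2.le⟩) hx.1.le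
  have hl := hmono.tendsto_nhdsWithin_Ioo_right (by simp) hbdd
  set l := sInf ((fun x => φ x / x) '' Set.Ioo 0 1)
  have hhalf : Tendsto (fun x : ℝ => 2⁻¹ * x) (𝓝[>] 0) (𝓝[>] 0) := by
    refine tendsto_nhdsWithin_iff.2 ⟨?_, ?_⟩
    · have : Tendsto (fun x : ℝ => 2⁻¹ * x) (𝓝 0) (𝓝 (2⁻¹ * 0)) := tendsto_id.const_mul _
      rw [mul_zero] at this
      exact this.mono_left nhdsWithin_le_nhds
    · filter_upwards [self_mem_nhdsWithin] with x hx
      have : (0 : ℝ) < x := hx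
      show 0 < 2⁻¹ * x
      positivity
  have h1 := hl.comp hhalf
  have h2 := ((h.regular 2⁻¹ (by norm_num)).const_mul 2).mul hl
  have h3 : l = 2 * (2⁻¹ : ℝ) ^ (1 + α) * l := by
    refine tendsto_nhds_unique h1 (h2.congr' ?_)
    filter_upwards [eventually_mem one_pos] with x hx
    have := h.pos hx.1 hx.2.le
    have := hx.1
    simp only [Function.comp]
    field_simp
  have h4 : 2 * (2⁻¹ : ℝ) ^ (1 + α) < 1 := by
    rw [Real.rpow_add (by norm_num), Real.rpow_one, ← mul_assoc]
    have : (2⁻¹ : ℝ) ^ α < 1 := Real.rpow_lt_one (by norm_num) (by norm_num) h.index_pos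
    linarith
  have h5 : l = 0 := by
    by_contra hne
    have : (1 - 2 * (2⁻¹ : ℝ) ^ (1 + α)) * l = 0 := by linarith
    rcases mul_eq_zero.1 this with h6 | h6
    · linarith
    · exact hne h6
  rwa [h5] at hl

/-- The normalized increment of `φ` along one step of the iteration converges to its index. -/
lemma tendsto_increment (h : CriticalStep φ α) :
    Tendsto (fun x => (φ x - φ (x - φ x)) * x / φ x ^ 2) (𝓝[>] 0) (𝓝 (1 + α)) := by
  have hs := tendsto_rpow_slope_one (1 + α)
  refine tendsto_order.2 ⟨fun u hu => ?_, fun u hu => ?_⟩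
  · obtain ⟨b, hb, hb0, hb1⟩ := (((hs.mono_left (nhdsWithin_mono 1 (s := Set.Iio 1)
      fun x hx => ne_of_lt hx)).eventually (lt_mem_nhds hu)).and
      (Ioo_mem_nhdsLT (zero_lt_one (α := ℝ)))).exists
    have hlim : Tendsto (fun x => (φ (b * x) / φ x - 1) / (b - 1)) (𝓝[>] 0)
        (𝓝 ((b ^ (1 + α) - 1) / (b - 1))) := ((h.regular b hb0).sub_const 1).div_const _
    filter_upwards [hlim.eventually (lt_mem_nhds hb), eventually_mem one_pos,
      h.tendsto_div_self.eventually (gt_mem_nhds (sub_pos.2 hb1))] with x hux hx hr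
    have hφ := h.pos hx.1 hx.2.le
    have hx0 := hx.1
    rw [div_lt_iff₀ hx0] at hr
    refine hux.trans_le ?_
    have hslope := h.convex.secant_mono (a := x) (x := b * x) (y := x - φ x)
      ⟨hx0.le, hx.2.le⟩ ⟨by positivity, by nlinarith [hx.2]⟩
      ⟨by nlinarith, by linarith [hx.2]⟩ (by nlinarith) (by linarith) (by nlinarith)
    have e1 : (φ (b * x) - φ x) / (b * x - x) = (φ (b * x) / φ x - 1) / (b - 1) * (φ x / x) := by
      have : b - 1 ≠ 0 := by linarith
      have : b * x - x ≠ 0 := by nlinarith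
      rw [show b * x - x = (b - 1) * x by ring]
      field_simp
    have e2 : (φ (x - φ x) - φ x) / (x - φ x - x) =
        (φ x - φ (x - φ x)) * x / φ x ^ 2 * (φ x / x) := by
      rw [show x - φ x - x = -φ x by ring]
      field_simp
      ring
    rw [e1, e2] at hslope
    exact le_of_mul_le_mul_right hslope (by positivity)
  · obtain ⟨b, hb, hb1, hb2⟩ := (((hs.mono_left (nhdsWithin_mono 1 (s := Set.Ioi 1)
      fun x hx => ne_of_gt hx)).eventually (gt_mem_nhds hu)).and
      (Ioo_mem_nhdsGT (one_lt_two (α := ℝ)))).exists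
    have hlim : Tendsto (fun x => (φ (b * x) / φ x - 1) / (b - 1)) (𝓝[>] 0)
        (𝓝 ((b ^ (1 + α) - 1) / (b - 1))) :=
      ((h.regular b (by linarith)).sub_const 1).div_const _
    filter_upwards [hlim.eventually (gt_mem_nhds hb), eventually_mem one_half_pos,
      h.tendsto_div_self.eventually (gt_mem_nhds one_pos)] with x hux hx hr
    have hφ := h.pos hx.1 (by linarith [hx.2])
    have hx0 := hx.1
    have hx2 := hx.2
    rw [div_lt_iff₀ hx0] at hr
    refine lt_of_le_of_lt ?_ hux
    have hslope := h.convex.secant_mono (a := x) (x := x - φ x) (y := b * x)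
      ⟨hx0.le, by linarith⟩ ⟨by linarith, by linarith⟩
      ⟨by positivity, by nlinarith⟩ (by linarith) (by nlinarith) (by nlinarith)
    have e1 : (φ (b * x) - φ x) / (b * x - x) = (φ (b * x) / φ x - 1) / (b - 1) * (φ x / x) := by
      have : b - 1 ≠ 0 := by linarith
      rw [show b * x - x = (b - 1) * x by ring]
      field_simp
    have e2 : (φ (x - φ x) - φ x) / (x - φ x - x) =
        (φ x - φ (x - φ x)) * x / φ x ^ 2 * (φ x / x) := by
      rw [show x - φ x - x = -φ x by ring]
      field_simp
      ring
    rw [e1, e2] at hslope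
    exact le_of_mul_le_mul_right hslope (by positivity)

lemma step_pos (h : CriticalStep φ α) {x : ℝ} (hx : 0 < x) (hx1 : x ≤ 1) : 0 < x - φ x := by
  obtain ⟨y, hy, hy0, hyx⟩ := ((h.tendsto_div_self.eventually (gt_mem_nhds one_pos)).and
    (eventually_mem hx)).exists
  rw [div_lt_iff₀ hy0] at hy
  have := h.monotone_step ⟨hy0.le, hyx.le.trans hx1⟩ ⟨hx.le, hx1⟩ hyx.le
  simp only at this
  linarith

lemma tendsto_timeScale_step (h : CriticalStep φ α) :
    Tendsto (fun x => timeScale φ (x - φ x) - timeScale φ x) (𝓝[>] 0) (𝓝 α) := by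
  have h1 := h.tendsto_increment
  have h2 := (h1.sub_const 1).div
    (tendsto_const_nhds.sub (h1.mul h.tendsto_div_self) : Tendsto _ _ (𝓝 (1 - (1 + α) * 0)))
    (by simp)
  rw [show (1 + α - 1) / (1 - (1 + α) * 0) = α by simp] at h2
  refine h2.congr' ?_
  filter_upwards [eventually_mem one_pos] with x hx
  have hφ := h.pos hx.1 hx.2.le
  have hs := h.step_pos hx.1 hx.2.le
  have hφ' := h.pos hs (by linarith [hx.2])
  have hx0 := hx.1
  simp only [Pi.div_apply, timeScale]
  have e : 1 - (φ x - φ (x - φ x)) * x / φ x ^ 2 * (φ x / x) = φ (x - φ x) / φ x := by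
    field_simp
    ring
  rw [e]
  field_simp
  ring

lemma tendsto_timeScale_mul (h : CriticalStep φ α) {c : ℝ} (hc : 0 < c) :
    Tendsto (fun x => timeScale φ (c * x) / timeScale φ x) (𝓝[>] 0) (𝓝 (c ^ (-α))) := by
  have h1 := ((h.regular c hc).inv₀ (by positivity)).const_mul c
  rw [show c * (c ^ (1 + α))⁻¹ = c ^ (-α) by
    rw [Real.rpow_add hc, Real.rpow_one, Real.rpow_neg hc.le]; field_simp] at h1
  refine h1.congr' ?_
  filter_upwards [eventually_mem one_pos] with x hx
  have := h.pos hx.1 hx.2.le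
  have := hx.1
  simp only [timeScale]
  field_simp

lemma timeScale_pos (h : CriticalStep φ α) {x : ℝ} (hx : 0 < x) (hx1 : x ≤ 1) :
    0 < timeScale φ x := div_pos hx (h.pos hx hx1)

lemma timeScale_anti (h : CriticalStep φ α) {x y : ℝ} (hx : 0 < x) (hxy : x ≤ y) (hy : y ≤ 1) :
    timeScale φ y ≤ timeScale φ x := by
  have := h.mul_map_le_mul_map hx.le hxy hy
  rw [timeScale, timeScale, div_le_div_iff₀ (h.pos (hx.trans_le hxy) hy) (h.pos hx (hxy.trans hy))]
  linarith

/-- The time scale, being monotone and regularly varying, can be inverted asymptotically. -/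
lemma tendsto_div_of_timeScale (h : CriticalStep φ α) {u v : ℕ → ℝ} {κ : ℝ} (hκ : 0 < κ)
    (hu : Tendsto u atTop (𝓝[>] 0)) (hv : ∀ᶠ n in atTop, 0 < v n ∧ v n ≤ 1)
    (huv : Tendsto (fun n => timeScale φ (v n) / timeScale φ (u n)) atTop (𝓝 κ)) :
    Tendsto (fun n => v n / u n) atTop (𝓝 (κ ^ (-1 / α))) := by
  have hα := h.index_pos
  have hu0 := hu.eventually (eventually_mem one_pos)
  have key : (κ ^ (-1 / α)) ^ (-α) = κ := by
    rw [← Real.rpow_mul hκ.le, show -1 / α * -α = 1 by field_simp, Real.rpow_one]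
  have hpos : 0 < κ ^ (-1 / α) := by positivity
  refine tendsto_order.2 ⟨fun c hc => ?_, fun c hc => ?_⟩
  · rcases le_or_gt c 0 with hc0 | hc0
    · filter_upwards [hu0, hv] with n h1 h2
      exact hc0.trans_lt (div_pos h2.1 h1.1)
    have hlt : κ < c ^ (-α) := by
      rw [← key]
      exact Real.rpow_lt_rpow_of_neg hc0 hc (by linarith)
    have hcu : ∀ᶠ n in atTop, 0 < u n ∧ u n < 1 / c := hu.eventually (eventually_mem (by positivity))
    filter_upwards [hu0, hv, hcu, huv.eventually_lt ((h.tendsto_timeScale_mul hc0).comp hu) hlt]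
      with n h1 h2 h3 h4
    rw [lt_div_iff₀ h1.1]
    by_contra! hle
    have h5 := h.timeScale_anti h2.1 hle (by have := h3.2; rw [lt_div_iff₀ hc0] at this; linarith)
    simp only [Function.comp] at h4
    rw [div_lt_div_iff_of_pos_right (h.timeScale_pos h1.1 h1.2.le)] at h4
    linarith
  · have hc0 : 0 < c := hpos.trans hc
    have hlt : c ^ (-α) < κ := by
      conv_rhs => rw [← key]
      exact Real.rpow_lt_rpow_of_neg hpos hc (by linarith)
    filter_upwards [hu0, hv, ((h.tendsto_timeScale_mul hc0).comp hu).eventually_lt huv hlt]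
      with n h1 h2 h4
    rw [div_lt_iff₀ h1.1]
    by_contra! hle
    have h5 := h.timeScale_anti (by have := h1.1; positivity) hle h2.2
    simp only [Function.comp] at h4
    rw [div_lt_div_iff_of_pos_right (h.timeScale_pos h1.1 h1.2.le)] at h4
    linarith

/-- The iteration with decrement `φ`. -/
def step (φ : ℝ → ℝ) (x : ℝ) : ℝ := x - φ x

lemma iterate_mem (h : CriticalStep φ α) {x : ℝ} (hx : 0 < x) (hx1 : x ≤ 1) (n : ℕ) :
    0 < (step φ)^[n] x ∧ (step φ)^[n] x ≤ x := by
  induction n with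
  | zero => exact ⟨hx, le_rfl⟩
  | succ n ih =>
    rw [Function.iterate_succ_apply']
    exact ⟨h.step_pos ih.1 (ih.2.trans hx1),
      (sub_le_self _ (h.nonneg _ ⟨ih.1.le, ih.2.trans hx1⟩)).trans ih.2⟩

lemma iterate_le_iterate (h : CriticalStep φ α) {x y : ℝ} (hx : 0 < x) (hxy : x ≤ y) (hy : y ≤ 1)
    (n : ℕ) : (step φ)^[n] x ≤ (step φ)^[n] y := by
  induction n with
  | zero => exact hxy
  | succ n ih =>
    rw [Function.iterate_succ_apply', Function.iterate_succ_apply']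
    have h1 := h.iterate_mem hx (hxy.trans hy) n
    have h2 := h.iterate_mem (hx.trans_le hxy) hy n
    exact h.monotone_step ⟨h1.1.le, h1.2.trans (hxy.trans hy)⟩ ⟨h2.1.le, h2.2.trans hy⟩ ih

lemma iterate_antitone (h : CriticalStep φ α) {x : ℝ} (hx : 0 < x) (hx1 : x ≤ 1) :
    Antitone fun n => (step φ)^[n] x := by
  refine antitone_nat_of_succ_le fun n => ?_
  have h1 := h.iterate_mem hx hx1 n
  rw [Function.iterate_succ_apply']
  exact sub_le_self _ (h.nonneg _ ⟨h1.1.le, h1.2.trans hx1⟩)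

lemma tendsto_iterate (h : CriticalStep φ α) :
    Tendsto (fun n => (step φ)^[n] 1) atTop (𝓝[>] 0) := by
  have hmem := h.iterate_mem one_pos le_rfl
  refine tendsto_nhdsWithin_iff.2 ⟨?_, Eventually.of_forall fun n => (hmem n).1⟩
  have hanti := h.iterate_antitone one_pos le_rfl
  refine tendsto_order.2 ⟨fun c hc => Eventually.of_forall fun n => hc.trans (hmem n).1,
    fun c hc => ?_⟩
  by_contra hcon
  have hge : ∀ n, c ≤ (step φ)^[n] 1 := by
    intro n
    by_contra! hlt
    exact hcon (eventually_atTop.2 ⟨n, fun m hm => (hanti hm).trans_lt hlt⟩)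
  have hc1 : c ≤ 1 := hge 0
  have hφ := h.pos hc hc1
  have hlin : ∀ n : ℕ, (step φ)^[n] 1 ≤ 1 - n * φ c := by
    intro n
    induction n with
    | zero => simp
    | succ n ih =>
      rw [Function.iterate_succ_apply', step]
      have := h.monotoneOn ⟨hc.le, hc1⟩ ⟨(hmem n).1.le, (hmem n).2⟩ (hge n)
      push_cast
      linarith
  obtain ⟨n, hn⟩ := exists_nat_gt (1 / φ c)
  rw [div_lt_iff₀ hφ] at hn
  linarith [hlin n, (hmem n).1]

lemma timeScale_iterate (h : CriticalStep φ α) {ε : ℝ} (hε : 0 < ε) :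
    ∃ δ > 0, ∀ x, 0 < x → x ≤ 1 → x < δ → ∀ n : ℕ,
      |timeScale φ ((step φ)^[n] x) - timeScale φ x - α * n| ≤ ε * n := by
  obtain ⟨δ, hδ, hsub⟩ := (mem_nhdsGT_iff_exists_Ioo_subset.1
    (h.tendsto_timeScale_step.eventually (Metric.ball_mem_nhds α hε)))
  refine ⟨δ, hδ, fun x hx hx1 hxδ n => ?_⟩
  induction n with
  | zero => simp
  | succ n ih =>
    have hmem := h.iterate_mem hx hx1 n
    have h1 : |_| < ε := hsub ⟨hmem.1, hmem.2.trans_lt hxδ⟩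
    rw [Function.iterate_succ_apply', step]
    push_cast
    rw [abs_lt] at h1
    rw [abs_le] at ih ⊢
    constructor <;> linarith

/-- Telescoping: partial sums of the orbit are increments of `x ^ 2 / φ x`. -/
lemma sum_iterate (h : CriticalStep φ α) {ε : ℝ} (hε : 0 < ε) :
    ∃ δ > 0, ∀ x, 0 < x → x ≤ 1 → x < δ → ∀ n : ℕ,
      |x * timeScale φ x - (step φ)^[n] x * timeScale φ ((step φ)^[n] x)
        - (1 - α) * ∑ k ∈ Finset.range n, (step φ)^[k] x|
        ≤ ε * ∑ k ∈ Finset.range n, (step φ)^[k] x := by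
  have hlim : Tendsto (fun x => 1 - (1 - φ x / x) *
      (timeScale φ (x - φ x) - timeScale φ x)) (𝓝[>] 0) (𝓝 (1 - α)) := by
    have := tendsto_const_nhds (x := (1 : ℝ)).sub
      ((tendsto_const_nhds (x := (1 : ℝ)).sub h.tendsto_div_self).mul h.tendsto_timeScale_step)
    simpa using this
  obtain ⟨δ, hδ, hsub⟩ := (mem_nhdsGT_iff_exists_Ioo_subset.1
    (hlim.eventually (Metric.ball_mem_nhds _ hε)))
  refine ⟨δ, hδ, fun x hx hx1 hxδ n => ?_⟩
  induction n with
  | zero => simp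
  | succ n ih =>
    have hmem := h.iterate_mem hx hx1 n
    have h1 : |_| < ε := hsub ⟨hmem.1, hmem.2.trans_lt hxδ⟩
    rw [Function.iterate_succ_apply', Finset.sum_range_succ]
    set y := (step φ)^[n] x
    have hy := hmem.1
    have hφ := h.pos hy (hmem.2.trans hx1)
    have e : y * timeScale φ y - step φ y * timeScale φ (step φ y) =
        y * (1 - (1 - φ y / y) * (timeScale φ (y - φ y) - timeScale φ y)) := by
      rw [step]
      simp only [timeScale]
      field_simp
      ring
    have h2 : |y * (1 - (1 - φ y / y) * (timeScale φ (y - φ y) - timeScale φ y)) - (1 - α) * y|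
        ≤ ε * y := by
      rw [mul_comm (1 - α), ← mul_sub, abs_mul, abs_of_pos hy, mul_comm ε]
      gcongr
    rw [← e] at h2
    rw [abs_le] at ih h2 ⊢
    constructor <;> linarith

lemma tendsto_timeScale_iterate_div (h : CriticalStep φ α) {u : ℕ → ℝ} {m : ℕ → ℕ} {τ : ℝ}
    (hu : Tendsto u atTop (𝓝[>] 0))
    (hm : Tendsto (fun n => (m n : ℝ) / timeScale φ (u n)) atTop (𝓝 τ)) :
    Tendsto (fun n => timeScale φ ((step φ)^[m n] (u n)) / timeScale φ (u n)) atTop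
      (𝓝 (1 + α * τ)) := by
  have hmain : Tendsto (fun n => timeScale φ ((step φ)^[m n] (u n)) / timeScale φ (u n)
      - (1 + α * ((m n : ℝ) / timeScale φ (u n)))) atTop (𝓝 0) := by
    rw [Metric.tendsto_nhds]
    intro ε hε
    have hden : 0 < |τ| + 1 := by positivity
    obtain ⟨δ, hδ, hb⟩ := h.timeScale_iterate (ε := ε / (2 * (|τ| + 1))) (by positivity)
    filter_upwards [hu.eventually (eventually_mem one_pos), hu.eventually (eventually_mem hδ),
      hm.eventually (gt_mem_nhds (lt_of_le_of_lt (le_abs_self τ) (lt_add_one |τ|)))]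
      with n h1 h2 h3
    have hW := h.timeScale_pos h1.1 h1.2.le
    have h4 := hb _ h1.1 h1.2.le h2.2 (m n)
    rw [Real.dist_eq, sub_zero]
    have e : timeScale φ ((step φ)^[m n] (u n)) / timeScale φ (u n)
        - (1 + α * ((m n : ℝ) / timeScale φ (u n))) =
        (timeScale φ ((step φ)^[m n] (u n)) - timeScale φ (u n) - α * m n)
          / timeScale φ (u n) := by
      field_simp
      ring
    rw [e, abs_div, abs_of_pos hW, div_lt_iff₀ hW]
    rw [div_lt_iff₀ hW] at h3
    calc _ ≤ _ := h4
      _ ≤ ε / (2 * (|τ| + 1)) * ((|τ| + 1) * timeScale φ (u n)) := by gcongr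
      _ = ε / 2 * timeScale φ (u n) := by field_simp
      _ < ε * timeScale φ (u n) := by gcongr; linarith
  have := hmain.add ((hm.const_mul α).const_add 1)
  simpa using this

lemma tendsto_timeScale_iterate_one (h : CriticalStep φ α) :
    Tendsto (fun n : ℕ => timeScale φ ((step φ)^[n] 1) / n) atTop (𝓝 α) := by
  rw [Metric.tendsto_nhds]
  intro ε hε
  obtain ⟨δ, hδ, hb⟩ := h.timeScale_iterate (ε := ε / 2) (by positivity)
  have hit := h.tendsto_iterate
  obtain ⟨N, -, hN⟩ := (hit.eventually (eventually_mem hδ)).exists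
  have hmemN := h.iterate_mem one_pos le_rfl N
  set C := |timeScale φ ((step φ)^[N] 1) - α * N| + ε / 2 * N with hC
  have hC0 : Tendsto (fun n : ℕ => C / n) atTop (𝓝 0) :=
    tendsto_const_div_atTop_nhds_zero_nat C
  filter_upwards [hC0.eventually (gt_mem_nhds (half_pos hε)), eventually_ge_atTop N,
    eventually_gt_atTop 0] with n h1 h2 h3
  have hn : (0 : ℝ) < n := by exact_mod_cast h3
  obtain ⟨j, rfl⟩ := Nat.exists_eq_add_of_le' h2
  have h4 := hb _ hmemN.1 hmemN.2 hN j
  rw [← Function.iterate_add_apply] at h4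
  rw [div_lt_iff₀ hn] at h1
  rw [Real.dist_eq, show timeScale φ ((step φ)^[j + N] 1) / ((j + N : ℕ) : ℝ) - α =
    (timeScale φ ((step φ)^[j + N] 1) - α * ((j + N : ℕ) : ℝ)) / ((j + N : ℕ) : ℝ) by field_simp,
    abs_div, abs_of_pos hn, div_lt_iff₀ hn]
  have h5 : |timeScale φ ((step φ)^[j + N] 1) - α * ((j + N : ℕ) : ℝ)| ≤
      |timeScale φ ((step φ)^[j + N] 1) - timeScale φ ((step φ)^[N] 1) - α * j| +
      |timeScale φ ((step φ)^[N] 1) - α * N| := by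
    refine le_trans (le_of_eq ?_) (abs_add_le _ _)
    push_cast
    ring_nf
  have h6 : (0 : ℝ) ≤ N := N.cast_nonneg
  push_cast at h1 h5 ⊢
  nlinarith

/-- A partial sum of the orbit started from a small point, when the end point is negligible up
to the factor `θ`. -/
lemma tendsto_sum_iterate_div (h : CriticalStep φ α) (hα : α < 1) {u : ℕ → ℝ} {m : ℕ → ℕ} {θ : ℝ}
    (hu : Tendsto u atTop (𝓝[>] 0))
    (hend : Tendsto (fun n => (step φ)^[m n] (u n) * timeScale φ ((step φ)^[m n] (u n)) /
      (u n * timeScale φ (u n))) atTop (𝓝 θ)) :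
    Tendsto (fun n => (∑ k ∈ Finset.range (m n), (step φ)^[k] (u n)) /
      (u n * timeScale φ (u n))) atTop (𝓝 ((1 - θ) / (1 - α))) := by
  have hratio : Tendsto (fun n => (∑ k ∈ Finset.range (m n), (step φ)^[k] (u n)) /
      (u n * timeScale φ (u n)) * (1 - α) - (1 - (step φ)^[m n] (u n) *
        timeScale φ ((step φ)^[m n] (u n)) / (u n * timeScale φ (u n)))) atTop (𝓝 0) := by
    have hα' : 0 < 1 - α := by linarith
    rw [Metric.tendsto_nhds]
    intro ε hε
    set η := min (ε / 4 * (1 - α)) ((1 - α) / 2)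
    have hη : 0 < η := by positivity
    have hη1 : η ≤ ε / 4 * (1 - α) := min_le_left _ _
    have hη2 : η ≤ (1 - α) / 2 := min_le_right _ _
    obtain ⟨δ, hδ, hb⟩ := h.sum_iterate hη
    filter_upwards [hu.eventually (eventually_mem one_pos), hu.eventually (eventually_mem hδ)]
      with n h1 h2
    have hW := h.timeScale_pos h1.1 h1.2.le
    have hU : 0 < u n * timeScale φ (u n) := mul_pos h1.1 hW
    have h4 := hb _ h1.1 h1.2.le h2.2 (m n)
    have hmem := h.iterate_mem h1.1 h1.2.le (m n)
    have hend0 : 0 < (step φ)^[m n] (u n) * timeScale φ ((step φ)^[m n] (u n)) :=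
      mul_pos hmem.1 (h.timeScale_pos hmem.1 (hmem.2.trans h1.2.le))
    have hS : 0 ≤ ∑ k ∈ Finset.range (m n), (step φ)^[k] (u n) :=
      Finset.sum_nonneg fun k _ => (h.iterate_mem h1.1 h1.2.le k).1.le
    set T := ∑ k ∈ Finset.range (m n), (step φ)^[k] (u n)
    set U := u n * timeScale φ (u n)
    set V := (step φ)^[m n] (u n) * timeScale φ ((step φ)^[m n] (u n))
    rw [Real.dist_eq, sub_zero, show T / U * (1 - α) - (1 - V / U) = -((U - V - (1 - α) * T) / U) by
      field_simp; ring, abs_neg, abs_div, abs_of_pos hU, div_lt_iff₀ hU]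
    have h5 : (1 - α) / 2 * T ≤ U := by
      have := (abs_le.1 h4).1
      nlinarith
    have h6 : η * T ≤ ε / 4 * (1 - α) * T := by gcongr
    have h7 : ε / 2 * ((1 - α) / 2 * T) ≤ ε / 2 * U := by gcongr
    have h8 : 0 < ε * U := by positivity
    linarith
  have h2 := (hratio.add (hend.const_sub 1)).div_const (1 - α)
  rw [zero_add] at h2
  refine h2.congr fun n => ?_
  have : 1 - α ≠ 0 := by linarith
  rw [sub_add_cancel]
  field_simp

end CriticalStep

namespace CriticalStep

variable {φ : ℝ → ℝ} {α : ℝ}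

/-- `x ^ 2 / φ x` decreases along the orbit of `1`, up to finitely many steps. -/
lemma eventually_mul_timeScale_le (h : CriticalStep φ α) (hα : α < 1) :
    ∀ᶠ n : ℕ in atTop, ∀ k, n ≤ k →
      (step φ)^[k] 1 * timeScale φ ((step φ)^[k] 1) ≤
        (step φ)^[n] 1 * timeScale φ ((step φ)^[n] 1) := by
  obtain ⟨δ, hδ, hb⟩ := h.sum_iterate (ε := 1 - α) (by linarith)
  filter_upwards [h.tendsto_iterate.eventually (eventually_mem hδ)] with n hn k hk
  obtain ⟨j, rfl⟩ := Nat.exists_eq_add_of_le' hk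
  have hmem := h.iterate_mem one_pos le_rfl n
  have h1 := (abs_le.1 (hb _ hmem.1 hmem.2 hn.2 j)).1
  rw [Function.iterate_add_apply]
  linarith

lemma tendsto_index_div (h : CriticalStep φ α) (hα : α < 1) {m : ℕ → ℕ}
    (hm : Tendsto m atTop atTop)
    (ho : Tendsto (fun n : ℕ => (n * (step φ)^[n] 1) / (m n * (step φ)^[m n] 1)) atTop (𝓝 0)) :
    Tendsto (fun n => (m n : ℝ) / n) atTop (𝓝 0) := by
  have hα0 := h.index_pos
  have hW := h.tendsto_timeScale_iterate_one
  have hWm := hW.comp hm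
  have hmem := h.iterate_mem one_pos le_rfl
  have hWpos : ∀ n, 0 < timeScale φ ((step φ)^[n] 1) := fun n =>
    h.timeScale_pos (hmem n).1 (hmem n).2
  have hmpos := hm.eventually (eventually_gt_atTop 0)
  have hU : Tendsto (fun n => ((step φ)^[n] 1 * timeScale φ ((step φ)^[n] 1)) /
      ((step φ)^[m n] 1 * timeScale φ ((step φ)^[m n] 1))) atTop (𝓝 0) := by
    have h1 := (hW.mul ho).mul (hWm.inv₀ hα0.ne')
    rw [mul_zero, zero_mul] at h1
    refine h1.congr' ?_
    filter_upwards [hmpos, eventually_gt_atTop 0] with n h2 h3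
    have h2' : (0 : ℝ) < m n := by exact_mod_cast h2
    have h3' : (0 : ℝ) < n := by exact_mod_cast h3
    have := hWpos n
    have := hWpos (m n)
    have := (hmem n).1
    have := (hmem (m n)).1
    simp only [Function.comp]
    field_simp
  have hratio : Tendsto (fun n => timeScale φ ((step φ)^[m n] 1) / timeScale φ ((step φ)^[n] 1))
      atTop (𝓝 0) := by
    refine tendsto_order.2 ⟨fun c hc => Eventually.of_forall fun n =>
      hc.trans (div_pos (hWpos _) (hWpos _)), fun ε hε => ?_⟩
    set δ := (ε / 4) ^ (1 / α)
    have hδ : 0 < δ := by positivity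
    have hδα : δ ^ (-α) = 4 / ε := by
      rw [← Real.rpow_mul (by positivity), show 1 / α * -α = -1 by field_simp, Real.rpow_neg_one]
      field_simp
    have hit := h.tendsto_iterate.comp hm
    have hlt : 2 / ε < δ ^ (-α) := by rw [hδα]; gcongr; norm_num
    filter_upwards [hU.eventually (gt_mem_nhds hδ), hU.eventually (gt_mem_nhds one_pos),
      h.eventually_mul_timeScale_le hα, hit.eventually (eventually_mem (b := 1 / δ) (by positivity)),
      ((h.tendsto_timeScale_mul hδ).comp hit).eventually (lt_mem_nhds hlt)] with n h1 h2 h3 h4 h5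
    have hX := hmem n
    have hY := hmem (m n)
    have hWX := hWpos n
    have hWY := hWpos (m n)
    simp only [Function.comp] at h4 h5
    have h4' := h4.2
    have hmn : m n ≤ n := by
      by_contra! hcon
      rw [div_lt_one (mul_pos hY.1 hWY)] at h2
      linarith [h3 _ hcon.le]
    have hXY := h.iterate_antitone one_pos le_rfl hmn
    simp only at hXY
    set X := (step φ)^[n] 1
    set Y := (step φ)^[m n] 1
    have hWle := h.timeScale_anti hX.1 hXY hY.2
    rw [div_lt_iff₀ (by have := hY.1; positivity)] at h1
    have hXδ : X ≤ δ * Y := by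
      have : X * timeScale φ X ≤ δ * Y * timeScale φ X := by
        have : δ * (Y * timeScale φ Y) ≤ δ * (Y * timeScale φ X) := by
          have := hY.1
          gcongr
        linarith
      exact le_of_mul_le_mul_right this hWX
    rw [lt_div_iff₀ hδ] at h4'
    have h6 := h.timeScale_anti hX.1 hXδ (by linarith)
    rw [lt_div_iff₀ hWY] at h5
    have h7 : 2 / ε * timeScale φ Y < timeScale φ X := h5.trans_le h6
    rw [div_lt_iff₀ hWX]
    have h8 : ε * (2 / ε * timeScale φ Y) < ε * timeScale φ X := by gcongr
    rw [show ε * (2 / ε * timeScale φ Y) = 2 * timeScale φ Y by field_simp] at h8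
    linarith
  have h1 := (hratio.mul (hWm.inv₀ hα0.ne')).mul hW
  rw [zero_mul, zero_mul] at h1
  refine h1.congr' ?_
  filter_upwards [hmpos, eventually_gt_atTop 0] with n h2 h3
  have h2' : (0 : ℝ) < m n := by exact_mod_cast h2
  have h3' : (0 : ℝ) < n := by exact_mod_cast h3
  have := hWpos n
  have := hWpos (m n)
  simp only [Function.comp]
  field_simp

/-- A critical iteration with an additional source term `(A - r k) * x k`. -/
lemma perturbed_bound (h : CriticalStep φ α) {A ε B : ℝ} {x y r : ℕ → ℝ} {m : ℕ}
    (hx : ∀ k, 0 ≤ x k) (hy : ∀ k, 0 ≤ y k) (hAε : 0 ≤ A + ε) (hB1 : B ≤ 1)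
    (hrec : ∀ k < m, y (k + 1) = y k - φ (y k) + (A - r k) * x k)
    (hB : y 0 + (A + ε) * ∑ k ∈ Finset.range m, x k ≤ B)
    (hr : ∀ k < m, y k ≤ B → |r k| ≤ ε) :
    |y m - y 0 - A * ∑ k ∈ Finset.range m, x k| ≤
      ε * ∑ k ∈ Finset.range m, x k + m * φ B := by
  have key : ∀ k ≤ m, y k ≤ y 0 + (A + ε) * ∑ j ∈ Finset.range k, x j ∧
      |y k - y 0 - A * ∑ j ∈ Finset.range k, x j| ≤
        ε * ∑ j ∈ Finset.range k, x j + k * φ B := by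
    intro k hk
    induction k with
    | zero => simp
    | succ k ih =>
      obtain ⟨ih1, ih2⟩ := ih (by omega)
      have hle : ∑ j ∈ Finset.range k, x j ≤ ∑ j ∈ Finset.range m, x j :=
        Finset.sum_le_sum_of_subset_of_nonneg (Finset.range_mono (by omega)) fun j _ _ => hx j
      have hyB : y k ≤ B := by
        have := mul_le_mul_of_nonneg_left hle hAε
        linarith
      have hφ0 := h.nonneg (y k) ⟨hy k, hyB.trans hB1⟩
      have hφB := h.monotoneOn ⟨hy k, hyB.trans hB1⟩ ⟨(hy k).trans hyB, hB1⟩ hyB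
      have hrx : |r k * x k| ≤ ε * x k := by
        rw [abs_mul, abs_of_nonneg (hx k)]
        exact mul_le_mul_of_nonneg_right (hr k (by omega) hyB) (hx k)
      rw [abs_le] at hrx ih2
      rw [hrec k (by omega), Finset.sum_range_succ, abs_le]
      push_cast
      refine ⟨?_, ?_, ?_⟩ <;> linarith
  exact (key m le_rfl).2

lemma tendsto_mul_map_div (h : CriticalStep φ α) {m : ℕ → ℕ} {K : ℝ} (hK : 0 < K)
    (hm : Tendsto (fun n => (m n : ℝ) / n) atTop (𝓝 0)) :
    Tendsto (fun n => m n * φ (K * (step φ)^[n] 1) / (step φ)^[n] 1) atTop (𝓝 0) := by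
  have hmem := h.iterate_mem one_pos le_rfl
  have h1 := (hm.mul (h.tendsto_timeScale_iterate_one.inv₀ h.index_pos.ne')).mul
    ((h.regular K hK).comp h.tendsto_iterate)
  rw [zero_mul, zero_mul] at h1
  refine h1.congr' ?_
  filter_upwards [eventually_gt_atTop 0] with n h3
  have h3' : (0 : ℝ) < n := by exact_mod_cast h3
  have := (hmem n).1
  have := h.pos (hmem n).1 (hmem n).2
  simp only [Function.comp, timeScale]
  field_simp

end CriticalStep

section GeneratingFunction

variable {Ω : Type*} [MeasurableSpace Ω] {P : Measure Ω} [IsProbabilityMeasure P] {Z : Ω → ℕ}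

lemma integrable_pow_of_mem_Icc (hZ : Measurable Z) {s : ℝ} (hs : 0 ≤ s) (hs1 : s ≤ 1) :
    Integrable (fun ω => s ^ Z ω) P := by
  refine Integrable.of_bound
    ((measurable_from_nat (f := fun k : ℕ => s ^ k)).comp hZ).aestronglyMeasurable 1 ?_
  filter_upwards with ω
  rw [Real.norm_eq_abs, abs_of_nonneg (by positivity)]
  exact pow_le_one₀ hs hs1

lemma one_sub_integral_zero_pow (hZ : Measurable Z) :
    1 - ∫ ω, (0 : ℝ) ^ Z ω ∂P = (P {ω | Z ω ≠ 0}).toReal := by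
  have hset : MeasurableSet {ω | Z ω ≠ 0} := hZ (measurableSet_singleton 0).compl
  have h1 : ∫ ω, (1 - (0 : ℝ) ^ Z ω) ∂P = (P {ω | Z ω ≠ 0}).toReal := by
    rw [← Measure.real_def, ← integral_indicator_one hset]
    refine integral_congr_ae (Eventually.of_forall fun ω => ?_)
    by_cases hω : Z ω = 0 <;> simp [hω]
  rw [← h1, integral_sub (integrable_const _) (integrable_pow_of_mem_Icc hZ le_rfl zero_le_one)]
  simp

lemma criticalStep_of_generatingFunction (hZ : Measurable Z)
    (hmean : ∫ ω, (Z ω : ℝ) ∂P = 1) {α : ℝ} (hα : 0 < α) {L : ℝ → ℝ}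
    (hF : ∀ s : ℝ, 0 ≤ s → s < 1 → ∫ ω, s ^ Z ω ∂P = s + (1 - s) ^ (1 + α) * L (1 - s))
    (hL : ∀ c : ℝ, 0 < c → Tendsto (fun x => L (c * x) / L x) (𝓝[>] 0) (𝓝 1)) :
    CriticalStep (fun x => (∫ ω, (1 - x) ^ Z ω ∂P) - (1 - x)) α where
  convex := by
    refine ⟨convex_Icc 0 1, fun x hx y hy a b ha hb hab => ?_⟩
    have hx' : (0 : ℝ) ≤ 1 - x ∧ 1 - x ≤ 1 := ⟨by linarith [hx.2], by linarith [hx.1]⟩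
    have hy' : (0 : ℝ) ≤ 1 - y ∧ 1 - y ≤ 1 := ⟨by linarith [hy.2], by linarith [hy.1]⟩
    have hxi := (integrable_pow_of_mem_Icc (P := P) hZ hx'.1 hx'.2).const_mul a
    have hyi := (integrable_pow_of_mem_Icc (P := P) hZ hy'.1 hy'.2).const_mul b
    have e : 1 - (a * x + b * y) = a * (1 - x) + b * (1 - y) := by linear_combination -hab
    have hmono : ∫ ω, (a * (1 - x) + b * (1 - y)) ^ Z ω ∂P ≤
        ∫ ω, (a * (1 - x) ^ Z ω + b * (1 - y) ^ Z ω) ∂P := by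
      refine integral_mono (integrable_pow_of_mem_Icc hZ ?_ ?_) (hxi.add hyi) fun ω => ?_
      · have := hx'.1
        have := hy'.1
        positivity
      · nlinarith [hx'.2, hy'.2]
      · exact (convexOn_pow (Z ω)).2 hx'.1 hy'.1 ha hb hab
    rw [integral_add hxi hyi, integral_const_mul, integral_const_mul] at hmono
    simp only [smul_eq_mul]
    rw [e]
    linarith
  map_zero := by simp
  nonneg := by
    intro x hx
    have hZi : Integrable (fun ω => (Z ω : ℝ)) P := by
      by_contra hcon
      rw [integral_undef hcon] at hmean
      exact zero_ne_one hmean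
    have hmono : ∫ ω, (1 + Z ω * -x) ∂P ≤ ∫ ω, (1 - x) ^ Z ω ∂P := by
      refine integral_mono ((integrable_const _).add (hZi.mul_const _))
        (integrable_pow_of_mem_Icc hZ (by linarith [hx.2]) (by linarith [hx.1])) fun ω => ?_
      have := one_add_mul_le_pow (a := -x) (by linarith [hx.2]) (Z ω)
      simpa [sub_eq_add_neg] using this
    rw [integral_add (integrable_const _) (hZi.mul_const _), integral_mul_const, hmean] at hmono
    simp at hmono
    linarith
  monotone_step := by
    intro x hx y hy hxy
    have hmono : ∫ ω, (1 - y) ^ Z ω ∂P ≤ ∫ ω, (1 - x) ^ Z ω ∂P := by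
      refine integral_mono (integrable_pow_of_mem_Icc hZ (by linarith [hy.2]) (by linarith [hy.1]))
        (integrable_pow_of_mem_Icc hZ (by linarith [hx.2]) (by linarith [hx.1])) fun ω => ?_
      exact pow_le_pow_left₀ (by linarith [hy.2]) (by linarith) _
    simp only
    linarith
  index_pos := hα
  regular := by
    intro c hc
    have h1 := (hL c hc).const_mul (c ^ (1 + α))
    rw [mul_one] at h1
    refine h1.congr' ?_
    filter_upwards [CriticalStep.eventually_mem one_pos,
      CriticalStep.eventually_mem (b := 1 / c) (by positivity)] with x hx hxc
    have hx0 := hx.1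
    have hxc' := hxc.2
    rw [lt_div_iff₀ hc] at hxc'
    have hcx : 0 < c * x := by positivity
    rw [hF (1 - x) (by linarith [hx.2]) (by linarith),
      hF (1 - c * x) (by linarith) (by linarith)]
    simp only [add_sub_cancel_left, sub_sub_cancel]
    rw [Real.mul_rpow hc.le hx0.le]
    have : x ^ (1 + α) ≠ 0 := by positivity
    rw [mul_assoc, mul_div_assoc, mul_div_mul_left _ _ this]

end GeneratingFunction

namespace GWSetup

open CriticalStep

variable (S : GWSetup)

/-- The decrement of the survival iteration of type-1 particles. -/
noncomputable def decr1 (x : ℝ) : ℝ := S.F1 1 (1 - x) - (1 - x)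

/-- The decrement of the survival iteration of type-2 particles. -/
noncomputable def decr2 (x : ℝ) : ℝ := S.F21 1 1 (1 - x) - (1 - x)

lemma criticalStep_decr1 : CriticalStep S.decr1 S.α1 :=
  let _ := S.mΩ
  have _ := S.hprob1
  criticalStep_of_generatingFunction (S.mZ1 1) S.hcrit1 S.hα1.1 S.hF1 S.hL1

lemma criticalStep_decr2 : CriticalStep S.decr2 S.α2 := by
  let _ := S.mΩ
  have _ := S.hprob2
  have h := criticalStep_of_generatingFunction (P := S.P2) (S.mZ2 1) S.hcrit2 S.hα2.1 (L := S.L2)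
    (fun s hs hs1 => by
      have := S.hF2 1 s zero_le_one le_rfl hs hs1
      simpa using this) S.hL2
  have e : S.decr2 = fun x => (∫ ω, (1 - x) ^ S.Z2 1 ω ∂S.P2) - (1 - x) := by
    ext x
    simp [decr2, F21]
  rwa [e]

lemma Q1s_eq_iterate {x : ℝ} (hx : 0 ≤ x) (hx1 : x ≤ 1) (n : ℕ) :
    S.Q1s n (1 - x) = (step S.decr1)^[n] x := by
  let _ := S.mΩ
  have _ := S.hprob1
  induction n with
  | zero =>
    have : ∫ ω, (1 - x) ^ S.Z1 0 ω ∂S.P1 = ∫ _, (1 - x) ∂S.P1 := by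
      refine integral_congr_ae ?_
      filter_upwards [S.hinit1] with ω hω
      rw [hω.1, pow_one]
    simp [Q1s, F1, this]
  | succ n ih =>
    have hb := S.hbranch1 1 n (1 - x) (by linarith) (by linarith)
    rw [Function.iterate_succ_apply', ← ih, step, decr1, Q1s, Q1s, sub_sub_cancel, add_comm n 1]
    rw [show S.F1 (1 + n) (1 - x) = S.F1 1 (S.F1 n (1 - x)) from hb]
    ring

lemma Q2s_eq_iterate {x : ℝ} (hx : 0 ≤ x) (hx1 : x ≤ 1) (n : ℕ) :
    S.Q2s n (1 - x) = (step S.decr2)^[n] x := by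
  let _ := S.mΩ
  have _ := S.hprob1
  have _ := S.hprob2
  induction n with
  | zero =>
    have : ∫ ω, (1 - x) ^ S.Z2 0 ω ∂S.P2 = ∫ _, (1 - x) ∂S.P2 := by
      refine integral_congr_ae ?_
      filter_upwards [S.hinit2] with ω hω
      rw [hω.2, pow_one]
    simp [Q2s, F21, this]
  | succ n ih =>
    have hb := S.hbranch2 1 n 1 (1 - x) zero_le_one le_rfl (by linarith) (by linarith)
    have hb' : S.F21 (1 + n) 1 (1 - x) = S.F21 1 1 (S.F21 n 1 (1 - x)) := by
      simpa [F21] using hb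
    rw [Function.iterate_succ_apply', ← ih, step, decr2, Q2s, Q2s, sub_sub_cancel, add_comm n 1,
      hb']
    ring

lemma Q1_eq_iterate (n : ℕ) : S.Q1 n = (step S.decr1)^[n] 1 := by
  let _ := S.mΩ
  have _ := S.hprob1
  rw [← S.Q1s_eq_iterate zero_le_one le_rfl, sub_self]
  exact (one_sub_integral_zero_pow (S.mZ1 n)).symm

lemma Q2_eq_iterate (n : ℕ) : S.Q2 n = (step S.decr2)^[n] 1 := by
  let _ := S.mΩ
  have _ := S.hprob2
  rw [← S.Q2s_eq_iterate zero_le_one le_rfl, sub_self, Q2, Q2s, F21]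
  simp only [one_pow, one_mul]
  exact (one_sub_integral_zero_pow (S.mZ2 n)).symm

lemma measurable_joint_pow (n : ℕ) (s1 s2 : ℝ) :
    letI := S.mΩ
    Measurable fun ω => s1 ^ S.Z1 n ω * s2 ^ S.Z2 n ω := by
  let _ := S.mΩ
  exact ((measurable_from_nat (f := fun k : ℕ => s1 ^ k)).comp (S.mZ1 n)).mul
    ((measurable_from_nat (f := fun k : ℕ => s2 ^ k)).comp (S.mZ2 n))

lemma F21_nonneg {s1 s2 : ℝ} (h1 : 0 ≤ s1) (h2 : 0 ≤ s2) (n : ℕ) : 0 ≤ S.F21 n s1 s2 :=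
  integral_nonneg fun _ => mul_nonneg (pow_nonneg h1 _) (pow_nonneg h2 _)

lemma Q2s_le_Q21s {s1 s2 : ℝ} (h1 : 0 ≤ s1) (h1' : s1 ≤ 1) (h2 : 0 ≤ s2) (h2' : s2 ≤ 1) (n : ℕ) :
    S.Q2s n s2 ≤ S.Q21s n s1 s2 := by
  let _ := S.mΩ
  have _ := S.hprob2
  have hint : ∀ t : ℝ, 0 ≤ t → t ≤ 1 →
      Integrable (fun ω => t ^ S.Z1 n ω * s2 ^ S.Z2 n ω) S.P2 := by
    intro t ht ht1
    refine Integrable.of_bound (S.measurable_joint_pow n t s2).aestronglyMeasurable 1 ?_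
    filter_upwards with ω
    rw [Real.norm_eq_abs, abs_of_nonneg (by positivity)]
    exact mul_le_one₀ (pow_le_one₀ ht ht1) (by positivity) (pow_le_one₀ h2 h2')
  refine sub_le_sub_left (integral_mono (hint s1 h1 h1') (hint 1 zero_le_one le_rfl) fun ω => ?_) 1
  have : s1 ^ S.Z1 n ω ≤ 1 ^ S.Z1 n ω := pow_le_pow_left₀ h1 h1' _
  exact mul_le_mul_of_nonneg_right this (by positivity)

lemma Q21s_zero (s1 s2 : ℝ) : S.Q21s 0 s1 s2 = 1 - s2 := by
  let _ := S.mΩ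
  have _ := S.hprob2
  have : ∫ ω, s1 ^ S.Z1 0 ω * s2 ^ S.Z2 0 ω ∂S.P2 = ∫ _, s2 ∂S.P2 := by
    refine integral_congr_ae ?_
    filter_upwards [S.hinit2] with ω hω
    rw [hω.1, hω.2, pow_one, pow_zero, one_mul]
  simp [Q21s, F21, this]

lemma Q21s_pos {x y : ℝ} (hx : 0 ≤ x) (hx1 : x ≤ 1) (hy : 0 < y) (hy1 : y ≤ 1) (n : ℕ) :
    0 < S.Q21s n (1 - x) (1 - y) := by
  have h := S.Q2s_le_Q21s (s1 := 1 - x) (s2 := 1 - y) (by linarith) (by linarith) (by linarith)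
    (by linarith) n
  rw [S.Q2s_eq_iterate hy.le hy1] at h
  exact (S.criticalStep_decr2.iterate_mem hy hy1 n).1.trans_le h

lemma Q21s_succ {x y : ℝ} (hx : 0 < x) (hx1 : x ≤ 1) (hy : 0 < y) (hy1 : y ≤ 1) (n : ℕ) :
    S.Q21s (n + 1) (1 - x) (1 - y) =
      S.Q21s n (1 - x) (1 - y) - S.decr2 (S.Q21s n (1 - x) (1 - y)) +
      (S.A21 - S.ρ (S.F1 n (1 - x)) (S.F21 n (1 - x) (1 - y))) * (step S.decr1)^[n] x := by
  have hx' : S.F1 n (1 - x) = 1 - (step S.decr1)^[n] x := by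
    rw [← S.Q1s_eq_iterate hx.le hx1, Q1s, sub_sub_cancel]
  have hmem := S.criticalStep_decr1.iterate_mem hx hx1 n
  have hF0 : 0 ≤ S.F21 n (1 - x) (1 - y) := S.F21_nonneg (by linarith) (by linarith) n
  have hF1 : S.F21 n (1 - x) (1 - y) < 1 := by
    have := S.Q21s_pos hx.le hx1 hy hy1 n
    rw [Q21s] at this
    linarith
  have hb := S.hbranch2 1 n (1 - x) (1 - y) (by linarith) (by linarith) (by linarith)
    (by linarith)
  have h1 := S.hF2 (S.F1 n (1 - x)) (S.F21 n (1 - x) (1 - y)) (by rw [hx']; linarith)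
    (by rw [hx']; linarith) hF0 hF1
  have h2 := S.hF2 1 (S.F21 n (1 - x) (1 - y)) zero_le_one le_rfl hF0 hF1
  have e0 : S.F21 (1 + n) (1 - x) (1 - y) = _ := hb.trans h1
  have e2 : S.F21 1 1 (S.F21 n (1 - x) (1 - y)) = _ := h2
  rw [Q21s, Q21s, decr2, sub_sub_cancel, add_comm n 1, e0, e2, hx']
  ring

end GWSetup

lemma asymp_const_mul_of_tendsto_div {f p : ℕ → ℝ} {C : ℝ} (hC : C ≠ 0)
    (h : Tendsto (fun n => f n / p n) atTop (𝓝 C)) : Asymp f fun n => C * p n := by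
  have := h.div_const C
  rw [div_self hC] at this
  exact this.congr fun n => by rw [div_div, mul_comm]

namespace GWSetup

open CriticalStep

variable (S : GWSetup)

lemma IsHStar.index_lt_one {S : GWSetup} {h : ℕ → ℕ} (hh : S.IsHStar h) : S.α1 < 1 := by
  refine lt_of_le_of_ne S.hα1.2 fun h1 => ?_
  have : (0 : ℝ) = 1 := by
    refine tendsto_nhds_unique (tendsto_const_nhds (x := (0 : ℝ)) (f := atTop (α := ℕ))) ?_
    refine Tendsto.congr (fun n => ?_) hh
    simp [h1]
  exact zero_ne_one this

lemma IsHStar.tendsto_div {S : GWSetup} {h : ℕ → ℕ} (hh : S.IsHStar h) :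
    Tendsto (fun n => (h n : ℝ) * S.Q1 (h n) / S.Q2 n) atTop
      (𝓝 ((1 - S.α1) / (S.α1 * S.A21))) := by
  have h1 := hh.index_lt_one
  have h2 := S.hα1.1
  have h3 := S.hA21
  have h4 : 0 < 1 - S.α1 := by linarith
  have := Tendsto.const_mul ((1 - S.α1) / (S.α1 * S.A21)) hh
  rw [mul_one] at this
  refine this.congr fun n => ?_
  field_simp

lemma Q1_pos (n : ℕ) : 0 < S.Q1 n := by
  rw [Q1_eq_iterate]
  exact (S.criticalStep_decr1.iterate_mem one_pos le_rfl n).1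

lemma Q2_pos (n : ℕ) : 0 < S.Q2 n := by
  rw [Q2_eq_iterate]
  exact (S.criticalStep_decr2.iterate_mem one_pos le_rfl n).1

lemma tendsto_Q1 : Tendsto S.Q1 atTop (𝓝[>] 0) :=
  S.criticalStep_decr1.tendsto_iterate.congr fun n => (S.Q1_eq_iterate n).symm

lemma tendsto_Q2 : Tendsto S.Q2 atTop (𝓝[>] 0) :=
  S.criticalStep_decr2.tendsto_iterate.congr fun n => (S.Q2_eq_iterate n).symm

lemma antitone_Q1 : Antitone S.Q1 := by
  have := S.criticalStep_decr1.iterate_antitone one_pos le_rfl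
  rwa [← funext S.Q1_eq_iterate] at this

lemma IsHStar.tendsto_atTop {S : GWSetup} {h : ℕ → ℕ} (hh : S.IsHStar h) :
    Tendsto h atTop atTop := by
  have h1 := hh.index_lt_one
  have hpos : 0 < (1 - S.α1) / (S.α1 * S.A21) :=
    div_pos (by linarith) (mul_pos S.hα1.1 S.hA21)
  have hlim : Tendsto (fun n => (h n : ℝ) * S.Q1 (h n)) atTop (𝓝 0) := by
    have := hh.tendsto_div.mul (S.tendsto_Q2.mono_right nhdsWithin_le_nhds)
    rw [mul_zero] at this
    refine this.congr fun n => ?_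
    rw [div_mul_cancel₀ _ (S.Q2_pos n).ne']
  refine Filter.tendsto_atTop.2 fun M => ?_
  filter_upwards [hlim.eventually (gt_mem_nhds (S.Q1_pos M)),
    hh.tendsto_div.eventually (lt_mem_nhds hpos)] with n h2 h3
  by_contra! hlt
  have h4 : h n ≠ 0 := by
    intro h0
    simp [h0] at h3
  have h5 : (1 : ℝ) ≤ h n := by exact_mod_cast Nat.one_le_iff_ne_zero.2 h4
  have h6 := S.antitone_Q1 hlt.le
  nlinarith [S.Q1_pos M]

lemma IsHStar.tendsto_div_self {S : GWSetup} {h : ℕ → ℕ} (hh : S.IsHStar h) (hA : S.CondA) :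
    Tendsto (fun n => (h n : ℝ) / n) atTop (𝓝 0) := by
  have h1 := hh.index_lt_one
  have hpos : 0 < (1 - S.α1) / (S.α1 * S.A21) :=
    div_pos (by linarith) (mul_pos S.hα1.1 S.hA21)
  refine S.criticalStep_decr1.tendsto_index_div h1 hh.tendsto_atTop ?_
  have h2 := Tendsto.div hA hh.tendsto_div hpos.ne'
  rw [zero_div] at h2
  refine h2.congr fun n => ?_
  have := S.Q2_pos n
  simp only [Pi.div_apply, ← Q1_eq_iterate]
  rw [div_div_div_cancel_right₀ this.ne']

section Start

variable {S} {h : ℕ → ℕ} {l : ℝ}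

lemma IsHStar.tendsto_start (hh : S.IsHStar h) (hl : 0 < l) :
    Tendsto (fun n => l * S.Q1 (h n)) atTop (𝓝[>] 0) := by
  have h1 := (S.tendsto_Q1.comp hh.tendsto_atTop)
  refine tendsto_nhdsWithin_iff.2 ⟨?_, Eventually.of_forall fun n => mul_pos hl (S.Q1_pos _)⟩
  have := (h1.mono_right nhdsWithin_le_nhds).const_mul l
  rwa [mul_zero] at this

lemma IsHStar.tendsto_timeScale_start (hh : S.IsHStar h) (hl : 0 < l) :
    Tendsto (fun n => timeScale S.decr1 (l * S.Q1 (h n)) / h n) atTop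
      (𝓝 (l ^ (-S.α1) * S.α1)) := by
  have hs := S.criticalStep_decr1
  have h1 := ((hs.tendsto_timeScale_mul hl).comp (S.tendsto_Q1.comp hh.tendsto_atTop)).mul
    (hs.tendsto_timeScale_iterate_one.comp hh.tendsto_atTop)
  refine h1.congr fun n => ?_
  have hQ1 : S.Q1 (h n) ≤ 1 := by
    rw [Q1_eq_iterate]
    exact (hs.iterate_mem one_pos le_rfl _).2
  have := hs.timeScale_pos (S.Q1_pos (h n)) hQ1
  simp only [Function.comp, ← Q1_eq_iterate]
  field_simp

lemma IsHStar.tendsto_mass_start (hh : S.IsHStar h) (hl : 0 < l) :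
    Tendsto (fun n => l * S.Q1 (h n) * timeScale S.decr1 (l * S.Q1 (h n)) / S.Q2 n) atTop
      (𝓝 (l ^ (1 - S.α1) / S.A21 * (1 - S.α1))) := by
  have h1 := ((hh.tendsto_timeScale_start hl).mul hh.tendsto_div).const_mul l
  have hα := S.hα1.1
  have hA := S.hA21
  rw [show l * (l ^ (-S.α1) * S.α1 * ((1 - S.α1) / (S.α1 * S.A21))) =
      l ^ (1 - S.α1) / S.A21 * (1 - S.α1) by
    rw [sub_eq_add_neg 1 S.α1, Real.rpow_add hl, Real.rpow_one]
    field_simp] at h1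
  refine h1.congr' ?_
  filter_upwards [hh.tendsto_atTop.eventually (eventually_gt_atTop 0)] with n hn
  have : (0 : ℝ) < h n := by exact_mod_cast hn
  field_simp

lemma sum_Q1s_eq {x : ℝ} (hx : 0 ≤ x) (hx1 : x ≤ 1) (m : ℕ) :
    ∑ k ∈ Finset.range m, S.Q1s k (1 - x) = ∑ k ∈ Finset.range m, (step S.decr1)^[k] x :=
  Finset.sum_congr rfl fun k _ => S.Q1s_eq_iterate hx hx1 k

lemma IsHStar.tendsto_sum_Q1s (hh : S.IsHStar h) (hl : 0 < l) {m : ℕ → ℕ} {θ : ℝ}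
    (hend : Tendsto (fun n => (step S.decr1)^[m n] (l * S.Q1 (h n)) *
      timeScale S.decr1 ((step S.decr1)^[m n] (l * S.Q1 (h n))) /
        (l * S.Q1 (h n) * timeScale S.decr1 (l * S.Q1 (h n)))) atTop (𝓝 θ)) :
    Tendsto (fun n => (∑ k ∈ Finset.range (m n), S.Q1s k (1 - l * S.Q1 (h n))) / S.Q2 n) atTop
      (𝓝 (l ^ (1 - S.α1) / S.A21 * (1 - θ))) := by
  have hα := hh.index_lt_one
  have hs := S.criticalStep_decr1
  have hu := hh.tendsto_start hl
  have h1 := (hs.tendsto_sum_iterate_div hα hu hend).mul (hh.tendsto_mass_start hl)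
  have h2 : 1 - S.α1 ≠ 0 := by linarith
  rw [show (1 - θ) / (1 - S.α1) * (l ^ (1 - S.α1) / S.A21 * (1 - S.α1)) =
    l ^ (1 - S.α1) / S.A21 * (1 - θ) by field_simp] at h1
  refine h1.congr' ?_
  filter_upwards [hu.eventually (eventually_mem one_pos)] with n hn
  have := hs.timeScale_pos hn.1 hn.2.le
  rw [sum_Q1s_eq hn.1.le hn.2.le, div_mul_div_cancel₀ (mul_pos hn.1 this).ne']

lemma IsHStar.tendsto_floor (hh : S.IsHStar h) {a : ℝ} (ha : 0 < a) :
    Tendsto (fun n => (⌊a * (h n : ℝ)⌋₊ : ℝ) / h n) atTop (𝓝 a) :=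
  (tendsto_nat_floor_mul_div_atTop ha.le).comp
    (tendsto_natCast_atTop_atTop.comp hh.tendsto_atTop)

lemma IsHStar.tendsto_mass_floor (hh : S.IsHStar h) (hl : 0 < l) {a : ℝ} (ha : 0 < a) :
    Tendsto (fun n => (step S.decr1)^[⌊a * (h n : ℝ)⌋₊] (l * S.Q1 (h n)) *
      timeScale S.decr1 ((step S.decr1)^[⌊a * (h n : ℝ)⌋₊] (l * S.Q1 (h n))) /
        (l * S.Q1 (h n) * timeScale S.decr1 (l * S.Q1 (h n)))) atTop
      (𝓝 ((1 + a * l ^ S.α1) ^ (1 - 1 / S.α1))) := by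
  have hs := S.criticalStep_decr1
  have hα := S.hα1.1
  have hu := hh.tendsto_start hl
  have hm : Tendsto (fun n => (⌊a * (h n : ℝ)⌋₊ : ℝ) / timeScale S.decr1 (l * S.Q1 (h n))) atTop
      (𝓝 (a * l ^ S.α1 / S.α1)) := by
    have h1 := (hh.tendsto_floor ha).div (hh.tendsto_timeScale_start hl) (by positivity)
    rw [show a / (l ^ (-S.α1) * S.α1) = a * l ^ S.α1 / S.α1 by
      rw [Real.rpow_neg hl.le]; field_simp] at h1
    refine h1.congr' ?_
    filter_upwards [hh.tendsto_atTop.eventually (eventually_gt_atTop 0)] with n hn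
    have : (0 : ℝ) < h n := by exact_mod_cast hn
    rw [Pi.div_apply, div_div_div_cancel_right₀ this.ne']
  have h1 := hs.tendsto_timeScale_iterate_div hu hm
  rw [show 1 + S.α1 * (a * l ^ S.α1 / S.α1) = 1 + a * l ^ S.α1 by field_simp] at h1
  have hκ : 0 < 1 + a * l ^ S.α1 := by positivity
  have h2 := hs.tendsto_div_of_timeScale hκ hu (by
    filter_upwards [hu.eventually (eventually_mem one_pos)] with n hn
    have := hs.iterate_mem hn.1 hn.2.le ⌊a * (h n : ℝ)⌋₊
    exact ⟨this.1, this.2.trans hn.2.le⟩) h1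
  have h3 := h2.mul h1
  rw [show (1 + a * l ^ S.α1) ^ (-1 / S.α1) * (1 + a * l ^ S.α1) =
      (1 + a * l ^ S.α1) ^ (1 - 1 / S.α1) by
    rw [show 1 - 1 / S.α1 = -1 / S.α1 + 1 by ring, Real.rpow_add hκ, Real.rpow_one]] at h3
  exact h3.congr fun n => div_mul_div_comm _ _ _ _

lemma IsHStar.tendsto_mass_self (hh : S.IsHStar h) (hA : S.CondA) (hl : 0 < l) :
    Tendsto (fun n => (step S.decr1)^[n] (l * S.Q1 (h n)) *
      timeScale S.decr1 ((step S.decr1)^[n] (l * S.Q1 (h n))) /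
        (l * S.Q1 (h n) * timeScale S.decr1 (l * S.Q1 (h n)))) atTop (𝓝 0) := by
  have hs := S.criticalStep_decr1
  have hα := S.hα1.1
  have hA21 := S.hA21
  have hα' := hh.index_lt_one
  have hα'' : 0 < 1 - S.α1 := by linarith
  have hu := hh.tendsto_start hl
  have hWn : Tendsto (fun n : ℕ => timeScale S.decr1 (l * S.Q1 (h n)) / n) atTop (𝓝 0) := by
    have h1 := (hh.tendsto_timeScale_start hl).mul (hh.tendsto_div_self hA)
    rw [mul_zero] at h1
    refine h1.congr' ?_
    filter_upwards [hh.tendsto_atTop.eventually (eventually_gt_atTop 0)] with n hn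
    have : (0 : ℝ) < h n := by exact_mod_cast hn
    field_simp
  have hmass := hh.tendsto_mass_start hl
  have hbound : Tendsto (fun n : ℕ => n * S.Q1 n / S.Q2 n *
      (timeScale S.decr1 (l * S.Q1 (h n)) / n + (S.α1 + 1)) /
      (l * S.Q1 (h n) * timeScale S.decr1 (l * S.Q1 (h n)) / S.Q2 n)) atTop (𝓝 0) := by
    have := (Tendsto.mul hA (hWn.add_const (S.α1 + 1))).div hmass (by positivity)
    rw [zero_mul, zero_div] at this
    exact this
  obtain ⟨δ, hδ, hb⟩ := hs.timeScale_iterate one_pos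
  have hev := (hu.eventually (eventually_mem one_pos)).and
    ((hu.eventually (eventually_mem hδ)).and (eventually_gt_atTop 0))
  refine tendsto_of_tendsto_of_tendsto_of_le_of_le' tendsto_const_nhds hbound ?_ ?_
  · filter_upwards [hev] with n hn
    have hm := hs.iterate_mem hn.1.1 hn.1.2.le n
    have h1 := hs.timeScale_pos hm.1 (hm.2.trans hn.1.2.le)
    have h2 := hs.timeScale_pos hn.1.1 hn.1.2.le
    exact (div_pos (mul_pos hm.1 h1) (mul_pos hn.1.1 h2)).le
  · filter_upwards [hev] with n hn
    have hm := hs.iterate_mem hn.1.1 hn.1.2.le n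
    have h1 := hs.timeScale_pos hm.1 (hm.2.trans hn.1.2.le)
    have h2 := hs.timeScale_pos hn.1.1 hn.1.2.le
    have h3 := (abs_le.1 (hb _ hn.1.1 hn.1.2.le hn.2.1.2 n)).2
    have h4 := hs.iterate_le_iterate hn.1.1 hn.1.2.le le_rfl n
    rw [← Q1_eq_iterate] at h4
    have hQ2 := S.Q2_pos n
    have hn0 : (0 : ℝ) < n := by exact_mod_cast hn.2.2
    have hU := mul_pos hn.1.1 h2
    set u := l * S.Q1 (h n)
    have e : n * S.Q1 n / S.Q2 n * (timeScale S.decr1 u / n + (S.α1 + 1)) /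
        (u * timeScale S.decr1 u / S.Q2 n) =
        S.Q1 n * (timeScale S.decr1 u + (S.α1 + 1) * n) / (u * timeScale S.decr1 u) := by
      field_simp
    rw [e]
    refine div_le_div_of_nonneg_right ?_ hU.le
    exact mul_le_mul h4 (by linarith) h1.le (S.Q1_pos n).le

lemma IsHStar.tendsto_Q21s (hh : S.IsHStar h) (hA : S.CondA) (hl : 0 < l) {l2 : ℝ} (hl2 : 0 < l2)
    {m : ℕ → ℕ} {σ : ℝ} (hm : Tendsto (fun n => (m n : ℝ) / h n) atTop (𝓝 σ)) {C : ℝ}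
    (hC : 0 ≤ C)
    (hsum : Tendsto (fun n => (∑ k ∈ Finset.range (m n), S.Q1s k (1 - l * S.Q1 (h n))) / S.Q2 n)
      atTop (𝓝 C)) :
    Tendsto (fun n => S.Q21s (m n) (1 - l * S.Q1 (h n)) (1 - l2 * S.Q2 n) / S.Q2 n) atTop
      (𝓝 (S.A21 * C + l2)) := by
  have hs1 := S.criticalStep_decr1
  have hs2 := S.criticalStep_decr2
  have hA21 := S.hA21
  have hu := hh.tendsto_start hl
  set K := l2 + (S.A21 + 1) * (C + 1) with hK
  have hK0 : 0 < K := by positivity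
  have hmn : Tendsto (fun n => (m n : ℝ) / n) atTop (𝓝 0) := by
    have h1 := hm.mul (hh.tendsto_div_self hA)
    rw [mul_zero] at h1
    refine h1.congr' ?_
    filter_upwards [hh.tendsto_atTop.eventually (eventually_gt_atTop 0)] with n hn
    have : (0 : ℝ) < h n := by exact_mod_cast hn
    field_simp
  have hsmall : Tendsto (fun n => m n * S.decr2 (K * S.Q2 n) / S.Q2 n) atTop (𝓝 0) := by
    simpa only [← Q2_eq_iterate] using hs2.tendsto_mul_map_div hK0 hmn
  have hmain : Tendsto (fun n => S.Q21s (m n) (1 - l * S.Q1 (h n)) (1 - l2 * S.Q2 n) / S.Q2 n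
      - (S.A21 * ((∑ k ∈ Finset.range (m n), S.Q1s k (1 - l * S.Q1 (h n))) / S.Q2 n) + l2))
      atTop (𝓝 0) := by
    rw [Metric.tendsto_nhds]
    intro η hη
    set ε := min 1 (η / (2 * (C + 1)))
    have hε : 0 < ε := by positivity
    have hε1 : ε ≤ 1 := min_le_left _ _
    have hε2 : ε * (C + 1) ≤ η / 2 := by
      have : ε ≤ η / (2 * (C + 1)) := min_le_right _ _
      calc ε * (C + 1) ≤ η / (2 * (C + 1)) * (C + 1) := by gcongr
        _ = η / 2 := by field_simp
    obtain ⟨δ, hδ, hρ⟩ := S.hρ ε hε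
    have hQK := S.tendsto_Q2.eventually (eventually_mem (b := min (1 / K) (δ / (2 * K)))
      (by positivity))
    filter_upwards [hu.eventually (eventually_mem one_pos), hQK,
      hu.eventually (eventually_mem (half_pos hδ)), hsum.eventually (gt_mem_nhds (lt_add_one C)),
      hsmall.eventually (gt_mem_nhds (half_pos hη))] with n hn1 hn2 hn3 hn4 hn5
    have hQ2 := S.Q2_pos n
    have hB1 : K * S.Q2 n ≤ 1 := by
      have := hn2.2.trans_le (min_le_left _ _)
      rw [lt_div_iff₀ hK0] at this
      linarith
    have hBδ : K * S.Q2 n < δ / 2 := by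
      have := hn2.2.trans_le (min_le_right _ _)
      rw [lt_div_iff₀ (by positivity)] at this
      linarith
    have hl2K : l2 ≤ K := by
      rw [hK]
      have : 0 ≤ (S.A21 + 1) * (C + 1) := by positivity
      linarith
    have hy0 : 0 < l2 * S.Q2 n := by positivity
    have hy1 : l2 * S.Q2 n ≤ 1 := (mul_le_mul_of_nonneg_right hl2K hQ2.le).trans hB1
    rw [sum_Q1s_eq hn1.1.le hn1.2.le] at hn4 ⊢
    set u := l * S.Q1 (h n)
    set y := fun k => S.Q21s k (1 - u) (1 - l2 * S.Q2 n)
    have hxm := hs1.iterate_mem hn1.1 hn1.2.le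
    have hypos : ∀ k, 0 < y k := S.Q21s_pos hn1.1.le hn1.2.le hy0 hy1
    have hyz : y 0 = l2 * S.Q2 n := by
      rw [show y 0 = 1 - (1 - l2 * S.Q2 n) from S.Q21s_zero _ _, sub_sub_cancel]
    rw [div_lt_iff₀ hQ2] at hn4 hn5
    have key := hs2.perturbed_bound (A := S.A21) (ε := ε) (B := K * S.Q2 n)
      (x := fun k => (step S.decr1)^[k] u) (y := y) (m := m n)
      (r := fun k => S.ρ (S.F1 k (1 - u)) (S.F21 k (1 - u) (1 - l2 * S.Q2 n)))
      (fun k => (hxm k).1.le) (fun k => (hypos k).le) (by positivity) hB1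
      (fun k _ => S.Q21s_succ hn1.1 hn1.2.le hy0 hy1 k)
      (by
        rw [hyz, hK, add_mul]
        have h1 : (S.A21 + ε) * ∑ k ∈ Finset.range (m n), (step S.decr1)^[k] u ≤
            (S.A21 + 1) * ((C + 1) * S.Q2 n) := by
          have := Finset.sum_nonneg fun k (_ : k ∈ Finset.range (m n)) => (hxm k).1.le
          gcongr
        linarith)
      (fun k _ hk => by
        have hxk := hxm k
        have hF1 : S.F1 k (1 - u) = 1 - (step S.decr1)^[k] u := by
          rw [← S.Q1s_eq_iterate hn1.1.le hn1.2.le, Q1s, sub_sub_cancel]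
        have hF21 : S.F21 k (1 - u) (1 - l2 * S.Q2 n) = 1 - y k := (sub_sub_cancel _ _).symm
        have hyk := hypos k
        rw [hF1, hF21]
        have hxy := mul_pos hxk.1 hyk
        refine (hρ _ _ ?_ ?_ ?_ ?_ ?_).le
        · linarith
        · linarith
        · linarith
        · linarith
        · linarith)
    rw [hyz] at key
    rw [Real.dist_eq, sub_zero]
    set T := ∑ k ∈ Finset.range (m n), (step S.decr1)^[k] u
    rw [show S.Q21s (m n) (1 - u) (1 - l2 * S.Q2 n) / S.Q2 n - (S.A21 * (T / S.Q2 n) + l2) =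
      (y (m n) - l2 * S.Q2 n - S.A21 * T) / S.Q2 n by field_simp; ring, abs_div, abs_of_pos hQ2,
      div_lt_iff₀ hQ2]
    have h2 : ε * T ≤ ε * ((C + 1) * S.Q2 n) := by gcongr
    have h3 : ε * (C + 1) * S.Q2 n ≤ η / 2 * S.Q2 n := by gcongr
    linarith
  have := hmain.add ((hsum.const_mul S.A21).add_const l2)
  simpa using this

end Start

end GWSetup

/-- Lemma `L_zub1`.  Under Condition (A), with `h*` as in
(2.1) and `s₁ = 1 - λ₁Q₁(h*(n))`, `s₂ = 1 - λ₂Q₂(n)`, for `λ₁, λ₂, a > 0`: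
`Σ_{k=0}^{n-1} Q₁(k;s₁) ~ (λ₁^{1-α₁}/A₂₁) Q₂(n)`,
`Σ_{k=0}^{⌊ah*(n)⌋-1} Q₁(k;s₁)
   ~ (λ₁^{1-α₁}/A₂₁)(1-(1+aλ₁^{α₁})^{1-1/α₁}) Q₂(n)`, and
`Q₂₁(⌊ah*(n)⌋; s₁, s₂)/Q₂(n)
   → λ₁^{1-α₁}(1-(1+aλ₁^{α₁})^{1-1/α₁}) + λ₂`. -/
theorem zub1_lemma (S : GWSetup) (hA : S.CondA)
    (hstar : ℕ → ℕ) (hhstar : S.IsHStar hstar)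
    (l1 l2 a : ℝ) (hl1 : 0 < l1) (hl2 : 0 < l2) (ha : 0 < a) :
    Asymp
      (fun n : ℕ => ∑ k ∈ Finset.range n, S.Q1s k (1 - l1 * S.Q1 (hstar n)))
      (fun n : ℕ => l1 ^ (1 - S.α1) / S.A21 * S.Q2 n) ∧
    Asymp
      (fun n : ℕ => ∑ k ∈ Finset.range ⌊a * (hstar n : ℝ)⌋₊,
        S.Q1s k (1 - l1 * S.Q1 (hstar n)))
      (fun n : ℕ => l1 ^ (1 - S.α1) / S.A21 *
        (1 - (1 + a * l1 ^ S.α1) ^ (1 - 1 / S.α1)) * S.Q2 n) ∧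
    Filter.Tendsto
      (fun n : ℕ => S.Q21s ⌊a * (hstar n : ℝ)⌋₊
        (1 - l1 * S.Q1 (hstar n)) (1 - l2 * S.Q2 n) / S.Q2 n)
      Filter.atTop
      (nhds (l1 ^ (1 - S.α1) * (1 - (1 + a * l1 ^ S.α1) ^ (1 - 1 / S.α1)) + l2)) := by
  have hα := S.hα1.1
  have hα1 := hhstar.index_lt_one
  have hA21 := S.hA21
  have hθ : (1 + a * l1 ^ S.α1) ^ (1 - 1 / S.α1) < 1 := by
    refine Real.rpow_lt_one_of_one_lt_of_neg (lt_add_of_pos_right 1 (by positivity)) ?_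
    rw [sub_neg, lt_div_iff₀ hα]
    linarith
  have hθ' := sub_pos.2 hθ
  have hself := hhstar.tendsto_sum_Q1s hl1 (hhstar.tendsto_mass_self hA hl1)
  rw [sub_zero, mul_one] at hself
  have hfloor := hhstar.tendsto_sum_Q1s hl1 (hhstar.tendsto_mass_floor hl1 ha)
  refine ⟨asymp_const_mul_of_tendsto_div (by positivity) hself,
    asymp_const_mul_of_tendsto_div (by positivity) hfloor, ?_⟩
  have h := hhstar.tendsto_Q21s hA hl1 hl2 (hhstar.tendsto_floor ha) (by positivity) hfloor
  rwa [← mul_assoc, mul_div_cancel₀ _ hA21.ne'] at h
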